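/- Let n₀ = 2^k with k ≥ 1 and let n = 2·n₀². There exist no positive divisor t of n + 2n₀ + 1 and integer g ≥ 2 such that 2g = (t − 1)·(n² − 1) − 2·t·n₀·(n − 1) and 2g < n². -/

import Mathlib

/-- Case (A) of the Suzuki analysis cannot occur. -/
theorem stmt_8 (k : ℕ) (hk : 1 ≤ k) (n₀ n : ℕ) (hn₀ : n₀ = 2 ^ k)
    (hn : n = 2 * n₀ ^ 2) :
    ¬ ∃ (t : ℕ) (g : ℤ), 0 < t ∧ t ∣ n + 2 * n₀ + 1 ∧ 2 ≤ g ∧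
      2 * g = ((t : ℤ) - 1) * ((n : ℤ) ^ 2 - 1) - 2 * (t : ℤ) * (n₀ : ℤ) * ((n : ℤ) - 1) ∧
      2 * g < (n : ℤ) ^ 2 := by
  rintro ⟨t, g, ht, hdvd, hg, hgenus, hlt⟩
  have hn₀_two : 2 ≤ n₀ := hn₀ ▸ Nat.le_self_pow (by omega) 2
  have ht_two : t ≠ 2 := by
    rintro rfl
    have : 2 ∣ n := ⟨n₀ ^ 2, hn⟩
    omega
  have hn' : (n : ℤ) = 2 * (n₀ : ℤ) ^ 2 := by exact_mod_cast hn
  have hn₀' : (2 : ℤ) ≤ n₀ := by exact_mod_cast hn₀_two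
  have hn_eight : (8 : ℤ) ≤ n := by nlinarith
  have hfactor : 2 * g = ((n : ℤ) - 1) * (t * (n + 1 - 2 * n₀) - (n + 1)) := by
    rw [hgenus]; ring
  have ht_one : t ≠ 1 := by
    rintro rfl
    push_cast at hfactor
    nlinarith
  have ht_three : (3 : ℤ) ≤ t := by omega
  have hbound : (t : ℤ) * (n + 1 - 2 * n₀) ≤ 2 * (n + 1) := by
    by_contra! h
    nlinarith
  have hpos : (0 : ℤ) ≤ n + 1 - 2 * n₀ := by nlinarith
  have hn₀_le : (n₀ : ℤ) ≤ 2 := by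
    by_contra! h
    nlinarith [mul_le_mul_of_nonneg_right ht_three hpos]
  obtain rfl : n₀ = 2 := by omega
  obtain rfl : n = 8 := by omega
  push_cast at hbound
  obtain rfl : t = 3 := by omega
  omega
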